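/- Let p ≥ 5 be a prime. There does not exist a nontrivial regular (v,k,λ,μ)-partial difference set in an Abelian group of order v = 8p^3 with k ≤ 4p^3 and Δ = (λ−μ)^2 + 4(k−μ) = 4p^2. -/

import Mathlib

variable {G : Type*} [CommGroup G] [DecidableEq G] [Fintype G]

/-- The number of representations of `g` as `d₁ * d₂⁻¹` with `d₁, d₂ ∈ D`, `d₁ ≠ d₂`. -/
def pdsReps (D : Finset G) (g : G) : ℕ :=
  ((D ×ˢ D).filter (fun x => x.1 ≠ x.2 ∧ x.1 * x.2⁻¹ = g)).card

/-- `D` is a `(v,k,λ,μ)`-partial difference set in `G`. -/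
def IsPDS (D : Finset G) (v k l m : ℕ) : Prop :=
  Fintype.card G = v ∧ D.card = k ∧
  (∀ g : G, g ≠ 1 → g ∈ D → pdsReps D g = l) ∧
  (∀ g : G, g ≠ 1 → g ∉ D → pdsReps D g = m)

/-- `D` is regular: closed under inverses and not containing the identity. -/
def IsRegularPDS (D : Finset G) : Prop :=
  (∀ d ∈ D, d⁻¹ ∈ D) ∧ (1 : G) ∉ D

/-- A regular PDS is trivial if `D ∪ {e}` or `G \ D` is a subgroup. -/
def IsTrivialPDS (D : Finset G) : Prop :=
  (∃ H : Subgroup G, (H : Set G) = ↑D ∪ {1}) ∨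
  (∃ H : Subgroup G, (H : Set G) = (↑D : Set G)ᶜ)

/-- Every element has at most `|D|` representations as a quotient of elements of `D`. -/
theorem pdsReps_le_card {H : Type*} [CommGroup H] [DecidableEq H] (D : Finset H) (g : H) :
    pdsReps D g ≤ D.card := by
  refine Finset.card_le_card_of_injOn Prod.fst ?_ ?_
  · intro x hx
    simp only [Finset.coe_filter, Finset.mem_product, Set.mem_ofPred_eq] at hx
    exact hx.1.1
  · intro x hx y hy hxy
    simp only [Finset.coe_filter, Finset.mem_product, Set.mem_ofPred_eq] at hx hy
    have h := hx.2.2.trans hy.2.2.symm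
    rw [hxy] at h
    exact Prod.ext hxy (inv_injective (mul_left_cancel h))

theorem sum_pdsReps (D : Finset G) :
    ∑ g ∈ Finset.univ.erase (1 : G), pdsReps D g = D.card * D.card - D.card := by
  rw [← Finset.offDiag_card, Finset.card_eq_sum_card_fiberwise
    (f := fun x : G × G => x.1 * x.2⁻¹) (t := Finset.univ.erase (1 : G))]
  · refine Finset.sum_congr rfl fun g _ => congrArg Finset.card ?_
    ext x
    simp only [Finset.mem_filter, Finset.mem_product, Finset.mem_offDiag]
    tauto
  · intro x hx
    have hne := (Finset.mem_offDiag.mp hx).2.2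
    simp [mul_inv_eq_one, hne]

/-- The standard counting identity for the parameters of a partial difference set. -/
theorem IsPDS.counting {D : Finset G} {v k l m : ℕ} (h : IsPDS D v k l m)
    (h1 : (1 : G) ∉ D) :
    (k : ℤ) ^ 2 = k + l * k + m * (v - 1 - k) := by
  obtain ⟨hv, hk, hl, hm⟩ := h
  have hsub : D ⊆ Finset.univ.erase (1 : G) := fun d hd =>
    Finset.mem_erase.mpr ⟨fun h => h1 (h ▸ hd), Finset.mem_univ d⟩
  have hsum := sum_pdsReps D
  rw [← Finset.sum_sdiff hsub,
    Finset.sum_congr rfl (g := fun _ => m) (fun g hg => hm g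
      (Finset.ne_of_mem_erase (Finset.mem_sdiff.mp hg).1) (Finset.mem_sdiff.mp hg).2),
    Finset.sum_congr rfl (g := fun _ => l) (fun g hg => hl g
      (Finset.ne_of_mem_erase (hsub hg)) hg)] at hsum
  simp only [Finset.sum_const, smul_eq_mul] at hsum
  have hc := Finset.card_sdiff_add_card_eq_card hsub
  rw [Finset.card_erase_of_mem (Finset.mem_univ _), Finset.card_univ, hv, hk] at hc
  have hv1 : 1 ≤ v := hv ▸ Fintype.card_pos
  have hkk : k ≤ k * k := Nat.le_mul_self k
  rw [hk] at hsum
  zify [hv1, hkk] at hc hsum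
  linear_combination (m : ℤ) * hc - hsum

/-- A regular partial difference set with `μ = 0` is a subgroup without the identity. -/
theorem IsPDS.isTrivialPDS_of_mu_eq_zero {D : Finset G} {v k l : ℕ} (h : IsPDS D v k l 0)
    (hreg : IsRegularPDS D) : IsTrivialPDS D := by
  obtain ⟨-, -, -, hm⟩ := h
  have hdiv : ∀ a ∈ D, ∀ b ∈ D, a ≠ b → a * b⁻¹ ∈ D := by
    intro a ha b hb hab
    by_contra hn
    have h0 := hm (a * b⁻¹) (by simpa [mul_inv_eq_one] using hab) hn
    rw [pdsReps, Finset.card_eq_zero] at h0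
    exact Finset.notMem_empty (a, b) (h0 ▸ by simp [ha, hb, hab])
  refine Or.inl ⟨Subgroup.ofDiv (↑D ∪ {1}) ⟨1, by simp⟩ ?_, rfl⟩
  rintro a (ha | rfl) b (hb | rfl)
  · by_cases hab : a = b
    · simp [hab]
    · exact Or.inl (hdiv a ha b hb hab)
  · simpa using Or.inr ha
  · simpa using Or.inr (hreg.1 b hb)
  · simp

/-- The parameters of a regular partial difference set in a group of order `8p³` with `Δ = 4p²`
force `μ = 0`; here `s` stands for `(λ - μ) / 2`. -/
theorem mu_eq_zero_of_parameters {p : ℕ} (hp : p.Prime) (hp5 : 5 ≤ p) {k m s : ℤ}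
    (hk0 : 0 ≤ k) (hk : k ≤ 4 * p ^ 3) (hmk : m ≤ k) (hkm : k - m = p ^ 2 - s ^ 2)
    (hcount : (k - s) ^ 2 = p ^ 2 + 8 * p ^ 3 * m) : m = 0 := by
  have hpZ : Prime (p : ℤ) := Nat.prime_iff_prime_int.mp hp
  have hp5' : (5 : ℤ) ≤ p := by exact_mod_cast hp5
  have hp0 : (p : ℤ) ≠ 0 := hpZ.ne_zero
  obtain ⟨hs1, hs2⟩ : -(p : ℤ) ≤ s ∧ s ≤ p := abs_le_of_sq_le_sq' (by linarith) (by linarith)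
  obtain ⟨t, ht⟩ : (p : ℤ) ∣ k - s :=
    hpZ.dvd_of_dvd_pow (n := 2) ⟨p + 8 * p ^ 2 * m, by rw [hcount]; ring⟩
  have ht2 : (t - 1) * (t + 1) = p * (8 * m) := by
    refine mul_left_cancel₀ (pow_ne_zero 2 hp0) ?_
    rw [ht] at hcount
    linear_combination hcount
  have hpodd : Odd (p : ℤ) := by
    exact_mod_cast hp.odd_of_ne_two (by omega)
  have htodd : Odd t := by
    by_contra hn
    have h2 : Even ((t - 1) * (t + 1)) := ht2 ▸ ⟨p * (4 * m), by ring⟩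
    rw [Int.not_odd_iff_even] at hn
    exact Int.not_even_iff_odd.mpr (hn.sub_odd odd_one |>.mul (hn.add_odd odd_one)) h2
  obtain ⟨ε, hε, c, hc⟩ : ∃ ε : ℤ, (ε = 1 ∨ ε = -1) ∧ (p : ℤ) ∣ t - ε := by
    rcases hpZ.dvd_or_dvd ⟨_, ht2⟩ with h | h
    · exact ⟨1, Or.inl rfl, h⟩
    · exact ⟨-1, Or.inr rfl, by simpa using h⟩
  have hεodd : Odd ε := by rcases hε with rfl | rfl <;> decide
  obtain ⟨j, rfl⟩ : (2 : ℤ) ∣ c := by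
    have h : Even ((p : ℤ) * c) := hc ▸ htodd.sub_odd hεodd
    rcases Int.even_mul.mp h with h | h
    · exact absurd hpodd (Int.not_odd_iff_even.mpr h)
    · exact h.two_dvd
  obtain rfl : t = ε + 2 * p * j := by linear_combination hc
  have hε2 : ε ^ 2 = 1 := by rcases hε with rfl | rfl <;> norm_num
  have hm : 2 * m = ε * j + p * j ^ 2 := by
    refine mul_left_cancel₀ (mul_ne_zero (by norm_num : (4 : ℤ) ≠ 0) hp0) ?_
    linear_combination hε2 - ht2
  have hkj : k = p * ε + 2 * p ^ 2 * j + s := by linear_combination ht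
  have hss : 0 ≤ s * (s + 1) := by
    rcases lt_or_ge s 0 with h | h <;> nlinarith
  have hf : 2 * (s * (s + 1)) = p * (j * (j - 4 * p)) + ε * j + 2 * p ^ 2 - 2 * ε * p := by
    linear_combination hm + 2 * hkm - 2 * hkj
  have hεl : -1 ≤ ε ∧ ε ≤ 1 := by rcases hε with rfl | rfl <;> norm_num
  have hj0 : 0 ≤ j := by
    by_contra! hn
    nlinarith [mul_le_mul_of_nonneg_left hεl.2 (by linarith : (0 : ℤ) ≤ p),
      mul_le_mul_of_nonneg_left (by linarith : j ≤ -1) (sq_nonneg (p : ℤ))]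
  have hj2 : j ≤ 2 * p := by
    by_contra! hn
    nlinarith [mul_le_mul_of_nonneg_left hεl.1 (by linarith : (0 : ℤ) ≤ p),
      mul_le_mul_of_nonneg_left (by linarith : 2 * (p : ℤ) + 1 ≤ j) (sq_nonneg (p : ℤ))]
  rcases hj0.eq_or_lt with rfl | hj
  · linarith
  · exfalso
    have h1 : 0 ≤ (j - 1) * (2 * p - j) := mul_nonneg (by linarith) (by linarith)
    have h2 : p * (j * (j - 4 * p)) ≤ p * (-2 * p * j + j - 2 * p) :=
      mul_le_mul_of_nonneg_left (by linarith) (by linarith)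
    have h3 : p ^ 2 * 1 ≤ p ^ 2 * j := mul_le_mul_of_nonneg_left (by linarith) (sq_nonneg (p : ℤ))
    rcases hε with rfl | rfl <;> nlinarith

/-- The case `Δ = 4p^2` cannot occur for a nontrivial regular PDS in an Abelian
group of order `8p^3` with `k ≤ 4p^3`, `p ≥ 5` prime. -/
theorem no_pds_delta_4p2 (p : ℕ) (hp : p.Prime) (hp5 : 5 ≤ p)
    {G : Type*} [CommGroup G] [DecidableEq G] [Fintype G]
    (D : Finset G) (k l m : ℕ)
    (hPDS : IsPDS D (8 * p ^ 3) k l m) (hreg : IsRegularPDS D)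
    (hnt : ¬ IsTrivialPDS D) (hk : k ≤ 4 * p ^ 3)
    (hΔ : ((l : ℤ) - m) ^ 2 + 4 * ((k : ℤ) - m) = 4 * p ^ 2) :
    False := by
  obtain rfl : m = 0 := by
    have hp3 : 5 ^ 3 ≤ p ^ 3 := Nat.pow_le_pow_left hp5 3
    obtain ⟨g, hg⟩ : ∃ g : G, g ∉ insert 1 D := by
      by_contra! hn
      have hcard := Finset.card_insert_le 1 D
      rw [Finset.eq_univ_of_forall hn, Finset.card_univ, hPDS.1, hPDS.2.1] at hcard
      omega
    obtain ⟨hg1, hgD⟩ := not_or.mp (Finset.mem_insert.not.mp hg)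
    have hmk : m ≤ k := by
      rw [← hPDS.2.2.2 g hg1 hgD, ← hPDS.2.1]
      exact pdsReps_le_card D g
    obtain ⟨s, hs⟩ : (2 : ℤ) ∣ l - m :=
      Int.prime_two.dvd_of_dvd_pow (n := 2)
        ⟨2 * p ^ 2 - 2 * (k - m), by linear_combination hΔ⟩
    have hcount := hPDS.counting hreg.2
    push_cast at hcount
    rw [hs] at hΔ
    have hkm : (k : ℤ) - m = p ^ 2 - s ^ 2 := by linarith
    exact_mod_cast mu_eq_zero_of_parameters hp hp5 (s := s) (Int.natCast_nonneg k)
      (by exact_mod_cast hk) (by exact_mod_cast hmk) hkm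
      (by linear_combination hcount + (k : ℤ) * hs + hkm)
  exact hnt (hPDS.isTrivialPDS_of_mu_eq_zero hreg)
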